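/- Let V = {1, 2, 3, 4}, let C be the 4-cycle with edge set {{1,2}, {2,3}, {3,4}, {4,1}}, and let M1 = {{1,3}, {2,4}} (the two diagonals, which form a perfect matching). Then there is no partition of the edge set of C into three matchings X0, X1, X2 such that for every j in {0, 1, 2} the graph on V with edge set M1 ∪ Xj is an acyclic 2-matching. -/

import Mathlib

/-- A set of edges is a matching: each edge is non-diagonal (joins two distinct
vertices) and no two distinct edges share a vertex. -/
def IsMatchingSet {V : Type*} (M : Finset (Sym2 V)) : Prop :=
  (∀ e ∈ M, ¬ e.IsDiag) ∧
    ∀ e ∈ M, ∀ f ∈ M, e ≠ f → ∀ v : V, v ∈ e → v ∉ f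

/-- A set of edges is a perfect matching: a matching covering every vertex. -/
def IsPerfectMatchingSet {V : Type*} (M : Finset (Sym2 V)) : Prop :=
  IsMatchingSet M ∧ ∀ v : V, ∃ e ∈ M, v ∈ e

/-- A set of edges is a 2-matching: each edge is non-diagonal and every vertex
is incident to at most two of the edges. -/
def IsTwoMatchingSet {V : Type*} [DecidableEq V] (C : Finset (Sym2 V)) : Prop :=
  (∀ e ∈ C, ¬ e.IsDiag) ∧
    ∀ v : V, (C.filter (fun e => v ∈ e)).card ≤ 2

/-- A set of edges is an acyclic 2-matching: a 2-matching whose associated graph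
contains no cycle, i.e. it is a vertex-disjoint union of paths. -/
def IsAcyclicTwoMatchingSet {V : Type*} [DecidableEq V] (C : Finset (Sym2 V)) : Prop :=
  IsTwoMatchingSet C ∧ (SimpleGraph.fromEdgeSet (↑C : Set (Sym2 V))).IsAcyclic

/-- An acyclic edge set does not contain the four edges of a 4-cycle. -/
theorem not_four_cycle_of_isAcyclic {V : Type*} {C : Set (Sym2 V)}
    (hC : (SimpleGraph.fromEdgeSet C).IsAcyclic) {a b c d : V}
    (hnodup : [a, b, c, d].Nodup) (hab : s(a, b) ∈ C) (hbc : s(b, c) ∈ C)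
    (hcd : s(c, d) ∈ C) (hda : s(d, a) ∈ C) : False := by
  simp only [List.nodup_cons, List.mem_cons, List.not_mem_nil, not_or, or_false] at hnodup
  obtain ⟨⟨nab, nac, nad⟩, ⟨nbc, nbd⟩, ncd, -⟩ := hnodup
  have adj {x y : V} (h : s(x, y) ∈ C) (hne : x ≠ y) : (SimpleGraph.fromEdgeSet C).Adj x y :=
    (SimpleGraph.fromEdgeSet_adj C).2 ⟨h, hne⟩
  refine hC (.cons (adj hab nab) (.cons (adj hbc nbc) (.cons (adj hcd ncd)
    (.cons (adj hda (Ne.symm nad)) .nil)))) ?_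
  rw [SimpleGraph.Walk.cons_isCycle_iff]
  simp [SimpleGraph.Walk.isPath_def]
  grind

/-- A matching contained in the 4-cycle whose union with the diagonals is acyclic has at most
one edge. -/
theorem card_le_one_of_union_diagonals_isAcyclic {X : Finset (Sym2 (Fin 4))}
    (hsub : X ⊆ {s(0, 1), s(1, 2), s(2, 3), s(3, 0)}) (hX : IsMatchingSet X)
    (hacyc : IsAcyclicTwoMatchingSet (({s(0, 2), s(1, 3)} : Finset (Sym2 (Fin 4))) ∪ X)) :
    X.card ≤ 1 := by
  have opposite₁ : ¬ (s(0, 1) ∈ X ∧ s(2, 3) ∈ X) := fun ⟨h, h'⟩ ↦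
    not_four_cycle_of_isAcyclic hacyc.2 (a := 0) (b := 2) (c := 3) (d := 1) (by decide)
      (by simp) (by simp [h']) (by simp [Sym2.eq_swap (a := (3 : Fin 4)) (b := 1)])
      (by simp [h, Sym2.eq_swap (a := (1 : Fin 4)) (b := 0)])
  have opposite₂ : ¬ (s(1, 2) ∈ X ∧ s(3, 0) ∈ X) := fun ⟨h, h'⟩ ↦
    not_four_cycle_of_isAcyclic hacyc.2 (a := 0) (b := 2) (c := 1) (d := 3) (by decide)
      (by simp) (by simp [h, Sym2.eq_swap (a := (2 : Fin 4)) (b := 1)]) (by simp) (by simp [h'])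
  rw [Finset.card_le_one]
  intro e he f hf
  by_contra hne
  have disj := hX.2 e he f hf hne
  have he' := hsub he
  have hf' := hsub hf
  simp only [Finset.mem_insert, Finset.mem_singleton] at he' hf'
  rcases he' with rfl | rfl | rfl | rfl <;> rcases hf' with rfl | rfl | rfl | rfl <;>
    first
    | exact hne rfl
    | exact opposite₁ ⟨he, hf⟩
    | exact opposite₁ ⟨hf, he⟩
    | exact opposite₂ ⟨he, hf⟩
    | exact opposite₂ ⟨hf, he⟩
    | exact absurd disj (by decide)

/-- On the vertex set `Fin 4` (vertices `0,1,2,3` standing for `1,2,3,4`),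
let `C` be the 4-cycle with edges `{01, 12, 23, 30}` and `M1 = {02, 13}` be the perfect
matching formed by the two diagonals. Then the edge set of `C` admits no partition into
three matchings `X0, X1, X2` such that each `M1 ∪ Xj` is an acyclic 2-matching. -/
theorem stmt3 :
    ¬ ∃ X0 X1 X2 : Finset (Sym2 (Fin 4)),
      Disjoint X0 X1 ∧ Disjoint X0 X2 ∧ Disjoint X1 X2 ∧
      X0 ∪ X1 ∪ X2 =
        ({s(0, 1), s(1, 2), s(2, 3), s(3, 0)} : Finset (Sym2 (Fin 4))) ∧
      IsMatchingSet X0 ∧ IsMatchingSet X1 ∧ IsMatchingSet X2 ∧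
      IsAcyclicTwoMatchingSet
        (({s(0, 2), s(1, 3)} : Finset (Sym2 (Fin 4))) ∪ X0) ∧
      IsAcyclicTwoMatchingSet
        (({s(0, 2), s(1, 3)} : Finset (Sym2 (Fin 4))) ∪ X1) ∧
      IsAcyclicTwoMatchingSet
        (({s(0, 2), s(1, 3)} : Finset (Sym2 (Fin 4))) ∪ X2) := by
  rintro ⟨X0, X1, X2, -, -, -, hunion, m0, m1, m2, a0, a1, a2⟩
  have c0 := card_le_one_of_union_diagonals_isAcyclic (by rw [← hunion]; grind) m0 a0
  have c1 := card_le_one_of_union_diagonals_isAcyclic (by rw [← hunion]; grind) m1 a1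
  have c2 := card_le_one_of_union_diagonals_isAcyclic (by rw [← hunion]; grind) m2 a2
  have hcard : (X0 ∪ X1 ∪ X2).card = 4 := by rw [hunion]; decide
  have h01 := Finset.card_union_le X0 X1
  have h012 := Finset.card_union_le (X0 ∪ X1) X2
  omega
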